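/- Let k be a field and g a 3-Lie algebra over k, i.e. a k-vector space with an alternating trilinear bracket [·,·,·] satisfying the Filippov identity [[x,y,z],w,u] = [[x,w,u],y,z] + [x,[y,w,u],z] + [x,y,[z,w,u]]. Let X = k ⊕ g with Δ(a,x) = (a,x)⊗(1,0) + (1,0)⊗(0,x), Δ₃ = (Δ⊗id)∘Δ, and T((a,x)⊗(b,y)⊗(c,z)) = (abc, bc·x + [x,y,z]). For a trilinear map φ : g³ → g define Λ²(φ) : X^⊗3 → X by Λ²(φ)((a,x)⊗(b,y)⊗(c,z)) = (0, φ(x,y,z)). Then: (i) if φ is a 3-Lie 2-cocycle (i.e. [φ(x,y,z),w,u] + φ([x,y,z],w,u) − [φ(x,w,u),y,z] − [x,φ(y,w,u),z] − [x,y,φ(z,w,u)] − φ([x,w,u],y,z) − φ(x,[y,w,u],z) − φ(x,y,[z,w,u]) = 0 for all x,y,z,w,u), then Λ²(φ) is a TSD 2-cochain with δ²(Λ²(φ)) = 0; and (ii) for every linear h : g → g, Λ²(δ¹h) is a TSD 2-coboundary, where δ¹h(x,y,z) = h([x,y,z]) − [h(x),y,z] − [x,h(y),z] − [x,y,h(z)].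 Hence Λ² induces a well-defined map from second 3-Lie cohomology of g to second TSD cohomology of X. -/

import Mathlib

open TensorProduct

noncomputable section

section TSDCore

variable {k : Type*} [Field k] {X : Type*} [AddCommGroup X] [Module k X]

/-- The ternary comultiplication `Δ₃ = (Δ ⊗ id) ∘ Δ`. -/
def D3 (Δ : X →ₗ[k] X ⊗[k] X) : X →ₗ[k] (X ⊗[k] X) ⊗[k] X :=
  TensorProduct.map Δ LinearMap.id ∘ₗ Δ

/-- `f : X → X` is a ternary coderivation:
`Δ₃∘f = (f⊗id⊗id + id⊗f⊗id + id⊗id⊗f)∘Δ₃`. -/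
def IsTernaryCoderivation (Δ : X →ₗ[k] X ⊗[k] X) (f : X →ₗ[k] X) : Prop :=
  D3 Δ ∘ₗ f
    = (TensorProduct.map (TensorProduct.map f LinearMap.id) LinearMap.id
        + TensorProduct.map (TensorProduct.map LinearMap.id f) LinearMap.id
        + TensorProduct.map (LinearMap.id : X ⊗[k] X →ₗ[k] X ⊗[k] X) f) ∘ₗ D3 Δ

/-- The TSD 2-cochain condition
`Δ₃∘ψ = (ψ⊗T⊗T + T⊗ψ⊗T + T⊗T⊗ψ)∘sh∘(Δ₃⊗Δ₃⊗Δ₃)`, relative to the shuffle `sh`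
(which sends `x₁⊗…⊗x₉` to `x₁⊗x₄⊗x₇⊗x₂⊗x₅⊗x₈⊗x₃⊗x₆⊗x₉`). -/
def IsTSD2Cochain (Δ : X →ₗ[k] X ⊗[k] X) (T : (X ⊗[k] X) ⊗[k] X →ₗ[k] X)
    (sh : (((X ⊗[k] X) ⊗[k] X) ⊗[k] ((X ⊗[k] X) ⊗[k] X)) ⊗[k] ((X ⊗[k] X) ⊗[k] X) →ₗ[k]
      (((X ⊗[k] X) ⊗[k] X) ⊗[k] ((X ⊗[k] X) ⊗[k] X)) ⊗[k] ((X ⊗[k] X) ⊗[k] X))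
    (ψ : (X ⊗[k] X) ⊗[k] X →ₗ[k] X) : Prop :=
  D3 Δ ∘ₗ ψ
    = (TensorProduct.map (TensorProduct.map ψ T) T
        + TensorProduct.map (TensorProduct.map T ψ) T
        + TensorProduct.map (TensorProduct.map T T) ψ) ∘ₗ sh ∘ₗ
      TensorProduct.map (TensorProduct.map (D3 Δ) (D3 Δ)) (D3 Δ)

/-- The coalgebra-morphism condition `Δ₃∘T = (T⊗T⊗T)∘sh∘(Δ₃⊗Δ₃⊗Δ₃)`. -/
def IsCoalgMor3 (Δ : X →ₗ[k] X ⊗[k] X) (T : (X ⊗[k] X) ⊗[k] X →ₗ[k] X)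
    (sh : (((X ⊗[k] X) ⊗[k] X) ⊗[k] ((X ⊗[k] X) ⊗[k] X)) ⊗[k] ((X ⊗[k] X) ⊗[k] X) →ₗ[k]
      (((X ⊗[k] X) ⊗[k] X) ⊗[k] ((X ⊗[k] X) ⊗[k] X)) ⊗[k] ((X ⊗[k] X) ⊗[k] X)) : Prop :=
  D3 Δ ∘ₗ T
    = TensorProduct.map (TensorProduct.map T T) T ∘ₗ sh ∘ₗ
      TensorProduct.map (TensorProduct.map (D3 Δ) (D3 Δ)) (D3 Δ)

/-- The ternary self-distributivity condition
`T(T(x⊗y⊗z)⊗w⊗u) = T(T(x⊗w⁽¹⁾⊗u⁽¹⁾)⊗T(y⊗w⁽²⁾⊗u⁽²⁾)⊗T(z⊗w⁽³⁾⊗u⁽³⁾))`, stated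
compositionally on `X^{⊗3} ⊗ X^{⊗2}`, relative to the rearrangement `ρ` (which sends
`(x⊗y⊗z)⊗((w₁⊗w₂⊗w₃)⊗(u₁⊗u₂⊗u₃))` to `(x⊗w₁⊗u₁)⊗(y⊗w₂⊗u₂)⊗(z⊗w₃⊗u₃)`). -/
def IsTSDMap (Δ : X →ₗ[k] X ⊗[k] X) (T : (X ⊗[k] X) ⊗[k] X →ₗ[k] X)
    (ρ : ((X ⊗[k] X) ⊗[k] X) ⊗[k] (((X ⊗[k] X) ⊗[k] X) ⊗[k] ((X ⊗[k] X) ⊗[k] X)) →ₗ[k]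
      (((X ⊗[k] X) ⊗[k] X) ⊗[k] ((X ⊗[k] X) ⊗[k] X)) ⊗[k] ((X ⊗[k] X) ⊗[k] X)) : Prop :=
  T ∘ₗ (TensorProduct.assoc k X X X).symm.toLinearMap ∘ₗ
      TensorProduct.map T (LinearMap.id : X ⊗[k] X →ₗ[k] X ⊗[k] X)
    = T ∘ₗ TensorProduct.map (TensorProduct.map T T) T ∘ₗ ρ ∘ₗ
      TensorProduct.map LinearMap.id (TensorProduct.map (D3 Δ) (D3 Δ))

/-- The TSD first differential
`δ¹f(x⊗y⊗z) = f(T(x⊗y⊗z)) − T(f(x)⊗y⊗z) − T(x⊗f(y)⊗z) − T(x⊗y⊗f(z))`. -/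
def tsdD1 (T : (X ⊗[k] X) ⊗[k] X →ₗ[k] X) (f : X →ₗ[k] X) :
    (X ⊗[k] X) ⊗[k] X →ₗ[k] X :=
  f ∘ₗ T - T ∘ₗ TensorProduct.map (TensorProduct.map f LinearMap.id) LinearMap.id
    - T ∘ₗ TensorProduct.map (TensorProduct.map LinearMap.id f) LinearMap.id
    - T ∘ₗ TensorProduct.map (LinearMap.id : X ⊗[k] X →ₗ[k] X ⊗[k] X) f

/-- The TSD second differential `δ²ψ`, stated compositionally on `X^{⊗3} ⊗ X^{⊗2}`:
`δ²ψ(x⊗y⊗z⊗w⊗u) = T(ψ(x⊗y⊗z)⊗w⊗u) + ψ(T(x⊗y⊗z)⊗w⊗u)`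
`− ψ(T(x⊗w⁽¹⁾⊗u⁽¹⁾)⊗T(y⊗w⁽²⁾⊗u⁽²⁾)⊗T(z⊗w⁽³⁾⊗u⁽³⁾))`
`− T(ψ(x⊗w⁽¹⁾⊗u⁽¹⁾)⊗T(y⊗w⁽²⁾⊗u⁽²⁾)⊗T(z⊗w⁽³⁾⊗u⁽³⁾))`
`− T(T(x⊗w⁽¹⁾⊗u⁽¹⁾)⊗ψ(y⊗w⁽²⁾⊗u⁽²⁾)⊗T(z⊗w⁽³⁾⊗u⁽³⁾))`
`− T(T(x⊗w⁽¹⁾⊗u⁽¹⁾)⊗T(y⊗w⁽²⁾⊗u⁽²⁾)⊗ψ(z⊗w⁽³⁾⊗u⁽³⁾))`, relative to `ρ`. -/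
def tsdD2 (Δ : X →ₗ[k] X ⊗[k] X) (T : (X ⊗[k] X) ⊗[k] X →ₗ[k] X)
    (ρ : ((X ⊗[k] X) ⊗[k] X) ⊗[k] (((X ⊗[k] X) ⊗[k] X) ⊗[k] ((X ⊗[k] X) ⊗[k] X)) →ₗ[k]
      (((X ⊗[k] X) ⊗[k] X) ⊗[k] ((X ⊗[k] X) ⊗[k] X)) ⊗[k] ((X ⊗[k] X) ⊗[k] X))
    (ψ : (X ⊗[k] X) ⊗[k] X →ₗ[k] X) :
    ((X ⊗[k] X) ⊗[k] X) ⊗[k] (X ⊗[k] X) →ₗ[k] X :=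
  T ∘ₗ (TensorProduct.assoc k X X X).symm.toLinearMap ∘ₗ
      TensorProduct.map ψ (LinearMap.id : X ⊗[k] X →ₗ[k] X ⊗[k] X)
    + ψ ∘ₗ (TensorProduct.assoc k X X X).symm.toLinearMap ∘ₗ
      TensorProduct.map T (LinearMap.id : X ⊗[k] X →ₗ[k] X ⊗[k] X)
    - ψ ∘ₗ TensorProduct.map (TensorProduct.map T T) T ∘ₗ ρ ∘ₗ
      TensorProduct.map LinearMap.id (TensorProduct.map (D3 Δ) (D3 Δ))
    - T ∘ₗ TensorProduct.map (TensorProduct.map ψ T) T ∘ₗ ρ ∘ₗ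
      TensorProduct.map LinearMap.id (TensorProduct.map (D3 Δ) (D3 Δ))
    - T ∘ₗ TensorProduct.map (TensorProduct.map T ψ) T ∘ₗ ρ ∘ₗ
      TensorProduct.map LinearMap.id (TensorProduct.map (D3 Δ) (D3 Δ))
    - T ∘ₗ TensorProduct.map (TensorProduct.map T T) ψ ∘ₗ ρ ∘ₗ
      TensorProduct.map LinearMap.id (TensorProduct.map (D3 Δ) (D3 Δ))

end TSDCore

variable (k : Type*) [Field k] (g : Type*) [AddCommGroup g] [Module k g]

/-- The comultiplication `Δ(a,x) = (a,x)⊗(1,0) + (1,0)⊗(0,x)` on `X = k ⊕ g`. -/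
def Dmap : (k × g) →ₗ[k] (k × g) ⊗[k] (k × g) :=
  (TensorProduct.mk k (k × g) (k × g)).flip ((1 : k), (0 : g))
    + TensorProduct.mk k (k × g) (k × g) ((1 : k), (0 : g)) ∘ₗ
      (LinearMap.inr k k g ∘ₗ LinearMap.snd k k g)

variable (b : g →ₗ[k] g →ₗ[k] g →ₗ[k] g)

/-- The TSD map `T((a,x)⊗(b,y)⊗(c,z)) = (abc, bc·x + [x,y,z])` on `X = k ⊕ g`,
associated to a ternary bracket `b` on `g`. -/
def T3 : ((k × g) ⊗[k] (k × g)) ⊗[k] (k × g) →ₗ[k] (k × g) :=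
  LinearMap.inl k k g ∘ₗ LinearMap.mul' k k ∘ₗ
      TensorProduct.map (LinearMap.mul' k k ∘ₗ
        TensorProduct.map (LinearMap.fst k k g) (LinearMap.fst k k g)) (LinearMap.fst k k g)
    + LinearMap.inr k k g ∘ₗ
      ((TensorProduct.rid k g).toLinearMap ∘ₗ
          TensorProduct.map ((TensorProduct.rid k g).toLinearMap ∘ₗ
            TensorProduct.map (LinearMap.snd k k g) (LinearMap.fst k k g))
            (LinearMap.fst k k g)
        + TensorProduct.lift (TensorProduct.lift b) ∘ₗ
          TensorProduct.map
            (TensorProduct.map (LinearMap.snd k k g) (LinearMap.snd k k g))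
            (LinearMap.snd k k g))

/-- `Λ²(φ)((a,x)⊗(b,y)⊗(c,z)) = (0, φ(x,y,z))`. -/
def Lambda2 (φ : g →ₗ[k] g →ₗ[k] g →ₗ[k] g) :
    ((k × g) ⊗[k] (k × g)) ⊗[k] (k × g) →ₗ[k] (k × g) :=
  LinearMap.inr k k g ∘ₗ TensorProduct.lift (TensorProduct.lift φ) ∘ₗ
    TensorProduct.map (TensorProduct.map (LinearMap.snd k k g) (LinearMap.snd k k g))
      (LinearMap.snd k k g)

/-- The `3`-Lie first differential
`δ¹h(x,y,z) = h([x,y,z]) − [h(x),y,z] − [x,h(y),z] − [x,y,h(z)]` as a trilinear map. -/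
def lie3Delta1 (h : g →ₗ[k] g) : g →ₗ[k] g →ₗ[k] g →ₗ[k] g :=
  b.compr₂ (LinearMap.llcomp k g g g h) - b ∘ₗ h - b.compl₂ h
    - b.compr₂ (LinearMap.lcomp k g h)

section

variable (k : Type*) [Field k] (g : Type*) [AddCommGroup g] [Module k g]

theorem D3_Dmap_apply (p : k × g) :
    D3 (Dmap k g) p
      = (p ⊗ₜ[k] (1, 0)) ⊗ₜ[k] (1, 0) + ((1, 0) ⊗ₜ[k] (0, p.2)) ⊗ₜ[k] (1, 0)
        + ((1, 0) ⊗ₜ[k] (1, 0)) ⊗ₜ[k] (0, p.2) := by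
  have h0 : ((0 : k), (0 : g)) = 0 := rfl
  simp [D3, Dmap, add_tmul, h0]

theorem T3_tmul (b : g →ₗ[k] g →ₗ[k] g →ₗ[k] g) (p q r : k × g) :
    T3 k g b ((p ⊗ₜ[k] q) ⊗ₜ[k] r)
      = (p.1 * q.1 * r.1, (q.1 * r.1) • p.2 + b p.2 q.2 r.2) := by
  simp [T3, smul_smul, mul_comm]

theorem Lambda2_tmul (φ : g →ₗ[k] g →ₗ[k] g →ₗ[k] g) (p q r : k × g) :
    Lambda2 k g φ ((p ⊗ₜ[k] q) ⊗ₜ[k] r) = (0, φ p.2 q.2 r.2) := by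
  simp [Lambda2]

theorem lie3Delta1_apply (b : g →ₗ[k] g →ₗ[k] g →ₗ[k] g) (h : g →ₗ[k] g) (x y z : g) :
    lie3Delta1 k g b h x y z = h (b x y z) - b (h x) y z - b x (h y) z - b x y (h z) := by
  simp [lie3Delta1]

end

/-- For a `3`-Lie algebra `g` and the associated TSD object `X = k ⊕ g`:
(i) if `φ` is a `3`-Lie 2-cocycle then `Λ²(φ)` is a TSD 2-cochain with `δ²(Λ²(φ)) = 0`;
(ii) for every linear `h : g → g`, `Λ²(δ¹h)` is a TSD 2-coboundary.  Hence `Λ²` induces a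
well-defined map from second `3`-Lie cohomology to second TSD cohomology. -/
theorem stmt12 {k : Type*} [Field k] {g : Type*} [AddCommGroup g] [Module k g]
    (b : g →ₗ[k] g →ₗ[k] g →ₗ[k] g)
    (halt12 : ∀ x y : g, b x x y = 0) (halt23 : ∀ x y : g, b x y y = 0)
    (halt13 : ∀ x y : g, b x y x = 0)
    (hFI : ∀ x y z w u : g,
      b (b x y z) w u = b (b x w u) y z + b x (b y w u) z + b x y (b z w u))
    (sh : ((((k × g) ⊗[k] (k × g)) ⊗[k] (k × g)) ⊗[k]
              (((k × g) ⊗[k] (k × g)) ⊗[k] (k × g))) ⊗[k]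
            (((k × g) ⊗[k] (k × g)) ⊗[k] (k × g)) →ₗ[k]
          ((((k × g) ⊗[k] (k × g)) ⊗[k] (k × g)) ⊗[k]
              (((k × g) ⊗[k] (k × g)) ⊗[k] (k × g))) ⊗[k]
            (((k × g) ⊗[k] (k × g)) ⊗[k] (k × g)))
    (hsh : ∀ x1 x2 x3 x4 x5 x6 x7 x8 x9 : k × g,
      sh ((((x1 ⊗ₜ[k] x2) ⊗ₜ[k] x3) ⊗ₜ[k] ((x4 ⊗ₜ[k] x5) ⊗ₜ[k] x6)) ⊗ₜ[k]
            ((x7 ⊗ₜ[k] x8) ⊗ₜ[k] x9))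
        = (((x1 ⊗ₜ[k] x4) ⊗ₜ[k] x7) ⊗ₜ[k] ((x2 ⊗ₜ[k] x5) ⊗ₜ[k] x8)) ⊗ₜ[k]
            ((x3 ⊗ₜ[k] x6) ⊗ₜ[k] x9))
    (ρ : (((k × g) ⊗[k] (k × g)) ⊗[k] (k × g)) ⊗[k]
            ((((k × g) ⊗[k] (k × g)) ⊗[k] (k × g)) ⊗[k]
              (((k × g) ⊗[k] (k × g)) ⊗[k] (k × g))) →ₗ[k]
          ((((k × g) ⊗[k] (k × g)) ⊗[k] (k × g)) ⊗[k]
              (((k × g) ⊗[k] (k × g)) ⊗[k] (k × g))) ⊗[k]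
            (((k × g) ⊗[k] (k × g)) ⊗[k] (k × g)))
    (hρ : ∀ x y z w1 w2 w3 u1 u2 u3 : k × g,
      ρ (((x ⊗ₜ[k] y) ⊗ₜ[k] z) ⊗ₜ[k]
            (((w1 ⊗ₜ[k] w2) ⊗ₜ[k] w3) ⊗ₜ[k] ((u1 ⊗ₜ[k] u2) ⊗ₜ[k] u3)))
        = (((x ⊗ₜ[k] w1) ⊗ₜ[k] u1) ⊗ₜ[k] ((y ⊗ₜ[k] w2) ⊗ₜ[k] u2)) ⊗ₜ[k]
            ((z ⊗ₜ[k] w3) ⊗ₜ[k] u3))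
    (φ : g →ₗ[k] g →ₗ[k] g →ₗ[k] g) :
    ((∀ x y z w u : g,
        b (φ x y z) w u + φ (b x y z) w u
          - b (φ x w u) y z - b x (φ y w u) z - b x y (φ z w u)
          - φ (b x w u) y z - φ x (b y w u) z - φ x y (b z w u) = 0) →
      IsTSD2Cochain (Dmap k g) (T3 k g b) sh (Lambda2 k g φ)
        ∧ tsdD2 (Dmap k g) (T3 k g b) ρ (Lambda2 k g φ) = 0)
    ∧ (∀ h : g →ₗ[k] g,
        ∃ f : (k × g) →ₗ[k] (k × g), IsTernaryCoderivation (Dmap k g) f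
          ∧ Lambda2 k g (lie3Delta1 k g b h) = tsdD1 (T3 k g b) f) := by
  have h0 : ((0 : k), (0 : g)) = 0 := rfl
  refine ⟨fun hφ => ⟨?_, ?_⟩, fun h => ⟨LinearMap.inr k k g ∘ₗ h ∘ₗ LinearMap.snd k k g, ?_, ?_⟩⟩
  · refine TensorProduct.ext_threefold fun p q r => ?_
    simp [D3_Dmap_apply, Lambda2_tmul, T3_tmul, add_tmul, tmul_add, hsh, h0]
  · refine TensorProduct.ext <| TensorProduct.ext_threefold fun p q r =>
      TensorProduct.ext' fun s t => ?_
    have hc := hφ p.2 q.2 r.2 s.2 t.2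
    simp [tsdD2, D3_Dmap_apply, Lambda2_tmul, T3_tmul, add_tmul, tmul_add, hρ, h0]
    rw [← hc]
    module
  · refine LinearMap.ext fun p => ?_
    simp [D3_Dmap_apply, h0]
  · refine TensorProduct.ext_threefold fun p q r => ?_
    simp [tsdD1, Lambda2_tmul, T3_tmul, lie3Delta1_apply]
end
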